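/- For all integers n ≥ m ≥ 1, the following digamma identity holds: ψ₀(2n+1) − ψ₀(2n−m+1) + ψ₀(1) − ψ₀(m+1) + (2n−1)/(2n) + Σ_{k=0}^{m−2} 2(k+1)(k+n−m+1)(k+2n−2m+1) / (m(2n−m)(m−1−k)(k+2n−m+1)) = 0. (This identity is exactly what reduces the θ = 1, a = n−m−1/2 specialization of the mean von Neumann entropy formula of the quantum interpolating ensemble to ψ₀(mn − m²/2 + 1) − ψ₀(n + 1/2), the Bures–Hall value.) -/

import Mathlib

open Finset

/-- The digamma function `ψ₀ = Γ'/Γ`. -/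
noncomputable def psi0 (x : ℝ) : ℝ := deriv Real.Gamma x / Real.Gamma x

/-- The functional equation `ψ₀(x + 1) = ψ₀(x) + 1/x` for `x > 0`. -/
theorem psi0_add_one {x : ℝ} (hx : 0 < x) : psi0 (x + 1) = psi0 x + 1 / x := by
  have hΓ : Real.Gamma x ≠ 0 := (Real.Gamma_pos_of_pos hx).ne'
  have hd : DifferentiableAt ℝ Real.Gamma x :=
    Real.differentiableAt_Gamma fun k h => by
      have := Nat.cast_nonneg (α := ℝ) k
      linarith
  have key : deriv Real.Gamma (x + 1) = Real.Gamma x + x * deriv Real.Gamma x := by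
    rw [← deriv_comp_add_const]
    have hev : (fun y => Real.Gamma (y + 1)) =ᶠ[nhds x] fun y => y * Real.Gamma y := by
      filter_upwards [eventually_ne_nhds hx.ne'] with y hy using Real.Gamma_add_one hy
    rw [hev.deriv_eq]
    simpa using ((hasDerivAt_id' x).fun_mul hd.hasDerivAt).deriv
  unfold psi0
  rw [key, Real.Gamma_add_one hx.ne']
  field_simp
  ring

/-- A partial-fraction sum evaluated through digamma values. -/
theorem sum_partial_fractions_eq_psi0 (N c : ℝ) (p : ℕ) (hp : (p : ℝ) < N) :
    ∑ i ∈ Finset.range p,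
        (1 / ((i : ℝ) + 1) - 1 / (N - 1 - i) - (N - 2 * ((i : ℝ) + 1)) / c)
      = psi0 ((p : ℝ) + 1) - psi0 1 - (psi0 N - psi0 (N - p)) - p * (N - p - 1) / c := by
  induction p with
  | zero => simp
  | succ p ih =>
    push_cast at hp ⊢
    rw [Finset.sum_range_succ, ih (by linarith), psi0_add_one (x := (p : ℝ) + 1) (by positivity)]
    have h := psi0_add_one (x := N - 1 - p) (by linarith)
    rw [show N - 1 - (p : ℝ) + 1 = N - p by ring] at h
    rw [h, show N - ((p : ℝ) + 1) = N - 1 - p by ring]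
    ring

/-- **Digamma identity reducing the interpolating-ensemble mean von Neumann
entropy to the Bures–Hall value.** For all integers `n ≥ m ≥ 1`:
`ψ₀(2n+1) − ψ₀(2n−m+1) + ψ₀(1) − ψ₀(m+1) + (2n−1)/(2n)
  + Σ_{k=0}^{m−2} 2(k+1)(k+n−m+1)(k+2n−2m+1)/(m(2n−m)(m−1−k)(k+2n−m+1)) = 0`. -/
theorem digamma_identity_bures_hall (m n : ℕ) (hm : 1 ≤ m) (hmn : m ≤ n) :
    psi0 (2 * (n : ℝ) + 1) - psi0 (2 * (n : ℝ) - m + 1) + psi0 1 - psi0 ((m : ℝ) + 1)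
      + (2 * (n : ℝ) - 1) / (2 * (n : ℝ))
      + ∑ k ∈ Finset.range (m - 1),
          2 * ((k : ℝ) + 1) * ((k : ℝ) + n - m + 1) * ((k : ℝ) + 2 * n - 2 * m + 1)
            / ((m : ℝ) * (2 * (n : ℝ) - m) * ((m : ℝ) - 1 - k) * ((k : ℝ) + 2 * n - m + 1))
      = 0 := by
  obtain ⟨p, rfl⟩ : ∃ p, m = p + 1 := ⟨m - 1, by lia⟩
  have hn : (p : ℝ) + 1 ≤ n := by exact_mod_cast hmn
  have hp : (0 : ℝ) ≤ p := p.cast_nonneg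
  have hsum : ∀ k ∈ Finset.range p,
      2 * (((p - 1 - k : ℕ) : ℝ) + 1) * (((p - 1 - k : ℕ) : ℝ) + n - (p + 1 : ℝ) + 1)
          * (((p - 1 - k : ℕ) : ℝ) + 2 * n - 2 * (p + 1 : ℝ) + 1)
          / ((p + 1 : ℝ) * (2 * (n : ℝ) - (p + 1 : ℝ)) * ((p + 1 : ℝ) - 1 - ((p - 1 - k : ℕ) : ℝ))
            * (((p - 1 - k : ℕ) : ℝ) + 2 * n - (p + 1 : ℝ) + 1))
        = 1 / ((k : ℝ) + 1) - 1 / (2 * (n : ℝ) - 1 - k)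
          - (2 * (n : ℝ) - 2 * ((k : ℝ) + 1)) / ((p + 1 : ℝ) * (2 * (n : ℝ) - (p + 1 : ℝ))) := by
    intro k hk
    have hkp : k + 1 ≤ p := Finset.mem_range.mp hk
    have hkr : (k : ℝ) + 1 ≤ p := by exact_mod_cast hkp
    have hcast : ((p - 1 - k : ℕ) : ℝ) = p - 1 - k := by
      rw [Nat.sub_sub, Nat.cast_sub (by lia)]
      push_cast
      ring
    rw [hcast, show (p + 1 : ℝ) - 1 - (p - 1 - k) = k + 1 by ring,
      show (p : ℝ) - 1 - k + 2 * n - (p + 1 : ℝ) + 1 = 2 * n - 1 - k by ring]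
    have h1 : (k : ℝ) + 1 ≠ 0 := by positivity
    have h2 : 2 * (n : ℝ) - 1 - k ≠ 0 := by linarith
    have h3 : (p : ℝ) + 1 ≠ 0 := by positivity
    have h4 : 2 * (n : ℝ) - (p + 1 : ℝ) ≠ 0 := by linarith
    field_simp
    ring
  push_cast
  rw [← Finset.sum_range_reflect, Finset.sum_congr rfl hsum,
    sum_partial_fractions_eq_psi0 _ _ _ (by linarith), psi0_add_one (x := 2 * (n : ℝ)) (by linarith),
    psi0_add_one (x := (p : ℝ) + 1) (by positivity),
    show 2 * (n : ℝ) - (p + 1 : ℝ) + 1 = 2 * n - p by ring]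
  have h1 : (n : ℝ) ≠ 0 := by linarith
  have h2 : (p : ℝ) + 1 ≠ 0 := by positivity
  have h3 : 2 * (n : ℝ) - (p + 1 : ℝ) ≠ 0 := by linarith
  rw [show 2 * (n : ℝ) - p - 1 = 2 * n - (p + 1) by ring]
  field_simp
  ring
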